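/- The map d₀ ↦ δmax(d₀, 0) is non-decreasing on [0, D]; consequently, z₀(d₀) = δmax(d₀, 0) + d₀ is strictly increasing on [0, D]. -/

import Mathlib

open Metric Set Filter Topology

noncomputable def deltaFn {m : ℕ} (yg : EuclideanSpace ℝ (Fin m))
    (Φ : ℝ → EuclideanSpace ℝ (Fin m) → EuclideanSpace ℝ (Fin m))
    (y₀ : EuclideanSpace ℝ (Fin m)) (t : ℝ) : ℝ :=
  ‖yg - Φ t y₀‖

noncomputable def deltaMaxW {m : ℕ} (yg : EuclideanSpace ℝ (Fin m))
    (Φ : ℝ → EuclideanSpace ℝ (Fin m) → EuclideanSpace ℝ (Fin m))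
    (Δt : ℝ) (y₀ : EuclideanSpace ℝ (Fin m)) (t : ℝ) : ℝ :=
  sSup ((fun s => deltaFn yg Φ y₀ s) '' Set.Icc t (t + Δt))

noncomputable def deltaMax {m : ℕ} (yg : EuclideanSpace ℝ (Fin m))
    (Φ : ℝ → EuclideanSpace ℝ (Fin m) → EuclideanSpace ℝ (Fin m))
    (Δt : ℝ) (d₀ t : ℝ) : ℝ :=
  sSup ((fun y₀ => deltaMaxW yg Φ Δt y₀ t) '' Metric.sphere yg d₀)

section

variable {m : ℕ} {yg : EuclideanSpace ℝ (Fin m)} {D Δt d₀ t M : ℝ}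
  {Φ : ℝ → EuclideanSpace ℝ (Fin m) → EuclideanSpace ℝ (Fin m)} {y₀ : EuclideanSpace ℝ (Fin m)}

theorem deltaFn_le (hΦinv : ∀ t : ℝ, 0 ≤ t → ∀ y₀ ∈ closedBall yg D, Φ t y₀ ∈ closedBall yg D)
    (ht : 0 ≤ t) (hy₀ : y₀ ∈ closedBall yg D) : deltaFn yg Φ y₀ t ≤ D := by
  simpa [deltaFn, mem_closedBall, dist_eq_norm, norm_sub_rev] using hΦinv t ht y₀ hy₀

theorem deltaMax_le (hM : 0 ≤ M)
    (h : ∀ y₀ ∈ sphere yg d₀, ∀ s ∈ Icc t (t + Δt), deltaFn yg Φ y₀ s ≤ M) :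
    deltaMax yg Φ Δt d₀ t ≤ M := by
  refine Real.sSup_le ?_ hM
  rintro _ ⟨y₀, hy₀, rfl⟩
  refine Real.sSup_le ?_ hM
  rintro _ ⟨s, hs, rfl⟩
  exact h y₀ hy₀ s hs

theorem deltaFn_le_deltaMax
    (hΦinv : ∀ t : ℝ, 0 ≤ t → ∀ y₀ ∈ closedBall yg D, Φ t y₀ ∈ closedBall yg D)
    (hD : 0 ≤ D) (hd₀ : d₀ ≤ D) (ht : 0 ≤ t) (hy₀ : y₀ ∈ sphere yg d₀) {s : ℝ}
    (hs : s ∈ Icc t (t + Δt)) : deltaFn yg Φ y₀ s ≤ deltaMax yg Φ Δt d₀ t := by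
  have hbound : ∀ y ∈ sphere yg d₀, ∀ r ∈ Icc t (t + Δt), deltaFn yg Φ y r ≤ D :=
    fun y hy r hr => deltaFn_le hΦinv (ht.trans hr.1)
      (closedBall_subset_closedBall hd₀ (sphere_subset_closedBall hy))
  have hs' : deltaFn yg Φ y₀ s ≤ deltaMaxW yg Φ Δt y₀ t :=
    le_csSup ⟨D, forall_mem_image.2 fun r hr => hbound y₀ hy₀ r hr⟩ (mem_image_of_mem _ hs)
  refine hs'.trans (le_csSup ⟨D, forall_mem_image.2 fun y hy => ?_⟩ (mem_image_of_mem _ hy₀))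
  exact Real.sSup_le (forall_mem_image.2 fun r hr => hbound y hy r hr) hD

end

theorem stmt_16
    (m : ℕ) (hm : 1 ≤ m)
    (yg : EuclideanSpace ℝ (Fin m)) (D : ℝ) (hD : 0 < D)
    (f : EuclideanSpace ℝ (Fin m) → EuclideanSpace ℝ (Fin m))
    (hf : ContDiff ℝ 1 f)
    (Φ : ℝ → EuclideanSpace ℝ (Fin m) → EuclideanSpace ℝ (Fin m))
    (hΦ0 : ∀ y₀ ∈ Metric.closedBall yg D, Φ 0 y₀ = y₀)
    (hΦinv : ∀ t : ℝ, 0 ≤ t → ∀ y₀ ∈ Metric.closedBall yg D,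
      Φ t y₀ ∈ Metric.closedBall yg D)
    (hΦderiv : ∀ t : ℝ, 0 ≤ t → ∀ y₀ ∈ Metric.closedBall yg D,
      HasDerivAt (fun τ => Φ τ y₀) (f (Φ t y₀)) t)
    (hΦflow : ∀ s : ℝ, 0 ≤ s → ∀ t : ℝ, 0 ≤ t → ∀ y₀ ∈ Metric.closedBall yg D,
      Φ (s + t) y₀ = Φ t (Φ s y₀))
    (Δt : ℝ) (hΔt : 0 < Δt) :
    MonotoneOn (fun d₀ => deltaMax yg Φ Δt d₀ 0) (Set.Icc 0 D) ∧
    StrictMonoOn (fun d₀ => deltaMax yg Φ Δt d₀ 0 + d₀) (Set.Icc 0 D) := by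
  have hmono : MonotoneOn (fun d₀ => deltaMax yg Φ Δt d₀ 0) (Set.Icc 0 D) := by
    intro d₁ hd₁ d₂ hd₂ hd
    have hball : ∀ d ∈ Icc 0 D, ∀ y ∈ sphere yg d, y ∈ closedBall yg D := fun d hdD y hy =>
      closedBall_subset_closedBall hdD.2 (sphere_subset_closedBall hy)
    have hzero : ∀ d ∈ Icc 0 D, ∀ y ∈ sphere yg d, deltaFn yg Φ y 0 = d := fun d hdD y hy => by
      rw [deltaFn, hΦ0 y (hball d hdD y hy), norm_sub_rev, ← dist_eq_norm]
      exact hy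
    have hle : d₂ ≤ deltaMax yg Φ Δt d₂ 0 := by
      have : Nonempty (Fin m) := ⟨⟨0, hm⟩⟩
      obtain ⟨y, hy⟩ := (NormedSpace.sphere_nonempty (x := yg)).2 hd₂.1
      calc d₂ = deltaFn yg Φ y 0 := (hzero d₂ hd₂ y hy).symm
        _ ≤ _ := deltaFn_le_deltaMax hΦinv hD.le hd₂.2 le_rfl hy ⟨le_rfl, by linarith⟩
    refine deltaMax_le (hd₂.1.trans hle) fun y hy s hs => ?_
    have hyD := hball d₁ hd₁ y hy
    rcases le_total (deltaFn yg Φ y s) d₂ with hs₂ | hs₂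
    · exact hs₂.trans hle
    have hcont : ContinuousOn (deltaFn yg Φ y) (Icc 0 s) := fun r hr =>
      (continuousAt_const.sub (hΦderiv r hr.1 y hyD).continuousAt).norm.continuousWithinAt
    -- The trajectory crosses the sphere of radius `d₂`; restart the flow from the crossing point.
    obtain ⟨r, hr, hrd⟩ := intermediate_value_Icc hs.1 hcont
      ⟨(hzero d₁ hd₁ y hy).le.trans hd, hs₂⟩
    have hmem : Φ r y ∈ sphere yg d₂ := by
      rw [mem_sphere, dist_eq_norm, norm_sub_rev]
      exact hrd
    have hflow : deltaFn yg Φ (Φ r y) (s - r) = deltaFn yg Φ y s := by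
      rw [deltaFn, deltaFn, ← hΦflow r hr.1 (s - r) (sub_nonneg.2 hr.2) y hyD, add_sub_cancel]
    rw [← hflow]
    exact deltaFn_le_deltaMax hΦinv hD.le hd₂.2 le_rfl hmem
      ⟨sub_nonneg.2 hr.2, by linarith [hs.2, hr.1]⟩
  exact ⟨hmono, hmono.add_strictMono (strictMono_id.strictMonoOn _)⟩
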